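/- arXiv:0907.0402 — 2 statements merged into one kernel-verified Lean document; each statement's English description precedes it below -/
import Mathlib

section
/- (Hjorth's oscillation theorem) Let (X,d) be a complete separable metric space and G ≤ Isom(X,d) a group with |G| > 1. Then there exist x_0, x_1 ∈ X and a uniformly continuous f : closure{(π·x_0, π·x_1) : π ∈ G} → [0,1] such that for every ρ in the completion of G under the left-invariant metric (viewed as an isometric embedding X → X), there exist pairs (y_0,y_1), (z_0,z_1) ∈ {(ρ(π(x_0)), ρ(π(x_1))) : π ∈ G} with f(y_0,y_1) = 0 and f(z_0,z_1) = 1. -/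
open Metric Set Filter Topology

theorem dist_limit_of_isometries {X : Type*} [MetricSpace X] {ρ : X → X} {u : ℕ → X ≃ᵢ X}
    (hu : ∀ x, Tendsto (fun n => u n x) atTop (𝓝 (ρ x))) (x y : X) :
    dist (ρ x) (ρ y) = dist x y :=
  tendsto_nhds_unique ((hu x).dist (hu y)) (by simp [IsometryEquiv.dist_eq])

/-- If `ρ = lim uₙ` and `x` stays `ε`-far from the range of `ρ`, then the points `uₙ⁻¹ x`
eventually leave every ball of radius `η` with `2 * η < ε`, even after applying an isometric
embedding `σ`. -/
theorem eventually_le_dist_symm_apply {X : Type*} [MetricSpace X] {ρ σ : X → X} {u : ℕ → X ≃ᵢ X}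
    (hu : ∀ x, Tendsto (fun n => u n x) atTop (𝓝 (ρ x)))
    (hσ : ∀ x y, dist (σ x) (σ y) = dist x y) {x : X} {ε η : ℝ}
    (hx : ∀ y, ε ≤ dist x (ρ y)) (hη : 2 * η < ε) (q : X) :
    ∀ᶠ m in atTop, η ≤ dist (σ ((u m).symm x)) q := by
  by_contra h
  have h : ∃ᶠ m in atTop, dist (σ ((u m).symm x)) q < η := by
    simpa [Filter.Frequently] using h
  obtain ⟨m₀, hm₀⟩ := h.exists
  set w := (u m₀).symm x
  have hw : ∀ᶠ m in atTop, 2 * η < dist x (u m w) :=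
    (tendsto_const_nhds.dist (hu w)).eventually_const_lt (hη.trans_le (hx w))
  obtain ⟨m, hm, hm'⟩ := (h.and_eventually hw).exists
  have h₁ : dist x (u m w) = dist ((u m).symm x) w := by
    rw [← (u m).symm.dist_eq, (u m).symm_apply_apply]
  have h₂ := dist_triangle_right (σ ((u m).symm x)) (σ w) q
  rw [hσ] at h₂
  linarith

theorem uniformContinuous_one_sub_infDist_div {Y : Type*} [PseudoMetricSpace Y] (A : Set Y)
    (s : ℝ) : UniformContinuous fun p : Y => max 0 (1 - infDist p A / s) := by
  have h : UniformContinuous fun t : ℝ => max 0 (1 - t / s) := by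
    refine (LipschitzWith.id.const_max 0).uniformContinuous.comp
      (uniformContinuous_const.sub ?_)
    simpa only [div_eq_inv_mul] using Real.uniformContinuous_const_mul (x := s⁻¹)
  exact h.comp (uniformContinuous_infDist_pt A)

/-- The case in which every pointwise limit of elements of `G` is surjective. -/
theorem hjorth_oscillation_of_surjective {X : Type*} [MetricSpace X]
    (G : Subgroup (X ≃ᵢ X)) {x : X} {g : X ≃ᵢ X} (hgG : g ∈ G) (hgx : g x ≠ x) :
    ∃ f : X × X → ℝ, UniformContinuous f ∧ (∀ p, f p ∈ Set.Icc (0 : ℝ) 1) ∧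
      ∀ ρ : X → X, Function.Surjective ρ →
        (∃ u : ℕ → X ≃ᵢ X, (∀ n, u n ∈ G) ∧
          ∀ x : X, Tendsto (fun n => u n x) atTop (𝓝 (ρ x))) →
        (∃ π ∈ G, f (ρ (π x), ρ (π x)) = 0) ∧ (∃ π ∈ G, f (ρ (π x), ρ (π x)) = 1) := by
  set c := dist (g x) x
  have hc : 0 < c := dist_pos.mpr hgx
  set A : Set (X × X) := {p | dist p.1 x ≤ c / 3} with hA
  have hxA : (x, x) ∈ A := by simp [hA]; positivity
  refine ⟨fun p => max 0 (1 - infDist p A / (c / 3)),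
    uniformContinuous_one_sub_infDist_div A _, fun p => ⟨le_max_left _ _, max_le zero_le_one ?_⟩,
    ?_⟩
  · have : 0 ≤ infDist p A / (c / 3) := div_nonneg infDist_nonneg (by positivity)
    linarith
  rintro ρ hρ ⟨u, huG, hu⟩
  have approx : ∀ h ∈ G, ∃ π ∈ G, dist (ρ (π x)) (h x) < c / 3 := by
    intro h hh
    obtain ⟨w, hw⟩ := hρ (h x)
    have hlim := hu w
    rw [hw] at hlim
    obtain ⟨n, hn⟩ := (Metric.tendsto_nhds.mp hlim (c / 3) (by positivity)).exists
    refine ⟨(u n)⁻¹ * h, G.mul_mem (G.inv_mem (huG n)) hh, ?_⟩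
    rw [← hw, dist_limit_of_isometries hu, ← (u n).dist_eq, dist_comm]
    simpa using hn
  constructor
  · obtain ⟨π, hπ, hd⟩ := approx g hgG
    refine ⟨π, hπ, max_eq_left ?_⟩
    have : c / 3 ≤ infDist (ρ (π x), ρ (π x)) A := by
      refine (le_infDist ⟨_, hxA⟩).mpr fun p hp => ?_
      have hp : dist p.1 x ≤ c / 3 := hp
      have h₁ : dist (ρ (π x)) p.1 ≤ dist (ρ (π x), ρ (π x)) p := le_max_left _ _
      have h₂ := dist_triangle4 (g x) (ρ (π x)) p.1 x
      rw [dist_comm (g x) (ρ (π x))] at h₂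
      linarith
    have := (one_le_div (by positivity : 0 < c / 3)).mpr this
    linarith
  · obtain ⟨π, hπ, hd⟩ := approx 1 G.one_mem
    refine ⟨π, hπ, ?_⟩
    have : (ρ (π x), ρ (π x)) ∈ A := hd.le
    simp [infDist_zero_of_mem this]

/-- The case in which some pointwise limit of elements of `G` keeps a positive distance
from a point `x`. -/
theorem hjorth_oscillation_of_le_dist {X : Type*} [MetricSpace X]
    [TopologicalSpace.SeparableSpace X] (G : Subgroup (X ≃ᵢ X)) {ρ₀ : X → X} {u : ℕ → X ≃ᵢ X}
    (huG : ∀ n, u n ∈ G) (hu : ∀ x, Tendsto (fun n => u n x) atTop (𝓝 (ρ₀ x)))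
    {x : X} {ε : ℝ} (hε : 0 < ε) (hx : ∀ y, ε ≤ dist x (ρ₀ y)) :
    ∃ x₁ : X, ∃ f : X × X → ℝ, UniformContinuous f ∧ (∀ p, f p ∈ Set.Icc (0 : ℝ) 1) ∧
      ∀ ρ : X → X, (∀ x y, dist (ρ x) (ρ y) = dist x y) →
        (∃ π ∈ G, f (ρ (π x), ρ (π x₁)) = 0) ∧ (∃ π ∈ G, f (ρ (π x), ρ (π x₁)) = 1) := by
  have : Nonempty X := ⟨x⟩
  set q := TopologicalSpace.denseSeq X
  have hq : ∀ y : X, ∀ r > 0, ∃ n, dist y (q n) < r := fun y r hr =>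
    (TopologicalSpace.denseRange_denseSeq X).exists_dist_lt y hr
  obtain ⟨N, hN⟩ := Metric.cauchySeq_iff'.mp (hu x).cauchySeq (ε / 18) (by positivity)
  set A : Set (X × X) :=
    {p | ∃ n, dist p.1 (q n) < ε / 9 ∧ ∀ k ≤ n, ε / 3 ≤ dist p.2 (q k)}
  refine ⟨(u N).symm x, fun p => max 0 (1 - infDist p A / (ε / 9)),
    uniformContinuous_one_sub_infDist_div A _, fun p => ⟨le_max_left _ _, max_le zero_le_one ?_⟩,
    ?_⟩
  · have : 0 ≤ infDist p A / (ε / 9) := div_nonneg infDist_nonneg (by positivity)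
    linarith
  intro ρ hρ
  have exists_mem : ∃ π ∈ G, (ρ (π x), ρ (π ((u N).symm x))) ∈ A := by
    obtain ⟨n, hn⟩ := hq (ρ x) (ε / 18) (by positivity)
    have hfar : ∀ᶠ m in atTop, ∀ k ≤ n, ε / 3 ≤ dist (ρ ((u m).symm x)) (q k) :=
      (Set.finite_Iic n).eventually_all.mpr fun k _ =>
        eventually_le_dist_symm_apply hu hρ hx (by linarith) (q k)
    obtain ⟨m, hm, hmN⟩ := (hfar.and (eventually_ge_atTop N)).exists
    refine ⟨(u m)⁻¹ * u N, G.mul_mem (G.inv_mem (huG m)) (huG N), n, ?_, ?_⟩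
    · have h₁ : dist (ρ (((u m)⁻¹ * u N) x)) (ρ x) = dist (u m x) (u N x) := by
        rw [hρ, ← (u m).dist_eq, dist_comm]
        simp
      have h₂ := dist_triangle (ρ (((u m)⁻¹ * u N) x)) (ρ x) (q n)
      have h₃ := hN m hmN
      simp only
      linarith
    · intro k hk
      have h : ((u m)⁻¹ * u N) ((u N).symm x) = (u m).symm x := by
        rw [IsometryEquiv.mul_apply, IsometryEquiv.apply_symm_apply]; rfl
      simpa only [h] using hm k hk
  constructor
  · by_contra! hne
    have near : ∀ π ∈ G, ∃ n, dist (ρ (π x)) (q n) < 2 * ε / 9 ∧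
        ∀ k ≤ n, 2 * ε / 9 < dist (ρ (π ((u N).symm x))) (q k) := by
      intro π hπ
      have hlt : infDist (ρ (π x), ρ (π ((u N).symm x))) A < ε / 9 := by
        by_contra! hle
        have := (one_le_div (by positivity : 0 < ε / 9)).mpr hle
        exact hne π hπ (max_eq_left (by linarith))
      obtain ⟨π₀, -, hπ₀⟩ := exists_mem
      obtain ⟨a, ⟨n, hn, hfar⟩, ha⟩ := (infDist_lt_iff ⟨_, hπ₀⟩).mp hlt
      obtain ⟨ha₁, ha₂⟩ := max_lt_iff.mp ha
      refine ⟨n, ?_, fun k hk => ?_⟩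
      · have := dist_triangle (ρ (π x)) a.1 (q n)
        simp only at ha₁
        linarith
      · have := dist_triangle_left a.2 (q k) (ρ (π ((u N).symm x)))
        have := hfar k hk
        simp only at ha₂
        linarith
    classical
    have hex : ∃ n, ∃ π ∈ G, dist (ρ (π x)) (q n) < 2 * ε / 9 := by
      obtain ⟨n, hn, -⟩ := near 1 G.one_mem
      exact ⟨n, 1, G.one_mem, hn⟩
    obtain ⟨π, hπ, hd⟩ := Nat.find_spec hex
    have hπN : π * u N ∈ G := G.mul_mem hπ (huG N)
    obtain ⟨n, hn, hfar⟩ := near _ hπN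
    have := hfar _ (Nat.find_min' hex ⟨_, hπN, hn⟩)
    rw [IsometryEquiv.mul_apply, IsometryEquiv.apply_symm_apply] at this
    exact this.not_gt hd
  · obtain ⟨π, hπ, hmem⟩ := exists_mem
    exact ⟨π, hπ, by simp [infDist_zero_of_mem hmem]⟩

/-- Hjorth's oscillation theorem: for a complete separable metric space `X` and a group
`G ≤ Isom(X,d)` with more than one element, there are `x₀, x₁ ∈ X` and a uniformly
continuous `f : closure {(π x₀, π x₁) : π ∈ G} → [0,1]` such that for every `ρ` in the
completion of `G` (i.e. every pointwise limit of a sequence of elements of `G`, an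
isometric embedding of `X` into itself), `f` takes both values `0` and `1` on
`{(ρ (π x₀), ρ (π x₁)) : π ∈ G}`. -/
theorem hjorth_oscillation {X : Type*} [MetricSpace X] [CompleteSpace X]
    [TopologicalSpace.SeparableSpace X]
    (G : Subgroup (X ≃ᵢ X)) (hG : ∃ g ∈ G, g ≠ 1) :
    ∃ x₀ x₁ : X, ∃ f : X × X → ℝ,
      UniformContinuousOn f (closure {p : X × X | ∃ π ∈ G, (π x₀, π x₁) = p}) ∧
      (∀ p ∈ closure {p : X × X | ∃ π ∈ G, (π x₀, π x₁) = p}, f p ∈ Set.Icc (0:ℝ) 1) ∧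
      ∀ ρ : X → X,
        (∃ u : ℕ → X ≃ᵢ X, (∀ n, u n ∈ G) ∧
          ∀ x : X, Tendsto (fun n => u n x) atTop (𝓝 (ρ x))) →
        (∃ π ∈ G, f (ρ (π x₀), ρ (π x₁)) = 0) ∧
        (∃ π ∈ G, f (ρ (π x₀), ρ (π x₁)) = 1) := by
  by_cases hsurj : ∀ ρ : X → X, (∃ u : ℕ → X ≃ᵢ X, (∀ n, u n ∈ G) ∧
      ∀ x : X, Tendsto (fun n => u n x) atTop (𝓝 (ρ x))) → Function.Surjective ρ
  · obtain ⟨g, hgG, hg⟩ := hG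
    obtain ⟨x, hx⟩ : ∃ x, g x ≠ x := by
      by_contra! h
      exact hg (IsometryEquiv.ext h)
    obtain ⟨f, hf, hf01, h⟩ := hjorth_oscillation_of_surjective G hgG hx
    exact ⟨x, x, f, hf.uniformContinuousOn, fun p _ => hf01 p, fun ρ hρ => h ρ (hsurj ρ hρ) hρ⟩
  · push Not at hsurj
    obtain ⟨ρ₀, ⟨u, huG, hu⟩, hns⟩ := hsurj
    obtain ⟨x, hx⟩ : ∃ x, x ∉ range ρ₀ := by simpa [Function.Surjective] using hns
    have hiso : Isometry ρ₀ := Isometry.of_dist_eq (dist_limit_of_isometries hu)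
    obtain ⟨ε, hε, hball⟩ :=
      Metric.isOpen_iff.mp hiso.isClosedEmbedding.isClosed_range.isOpen_compl x hx
    have hfar : ∀ y, ε ≤ dist x (ρ₀ y) := fun y => by
      by_contra! h
      exact hball (mem_ball'.mpr h) (mem_range_self y)
    obtain ⟨x₁, f, hf, hf01, h⟩ := hjorth_oscillation_of_le_dist G huG hu hε hfar
    exact ⟨x, x₁, f, hf.uniformContinuousOn, fun p _ => hf01 p,
      fun ρ ⟨_, _, hv⟩ => h ρ (dist_limit_of_isometries hv)⟩
end

section
/- Let M be an approximately ultrahomogeneous Polish relational metric structure with |Aut(M)| > 1. Then there exist a uniformly continuous f : M² → [0,1] and (a_0,a_1) ∈ M² such that for every morphism ρ : M → M there are pairs (b_0,b_1), (c_0,c_1) in the image of ρ × ρ, both with the same quantifier-free type as (a_0,a_1), with f(b_0,b_1) = 1 and f(c_0,c_1) = 0. -/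
open Metric Set

/-- Two `n`-tuples have the same quantifier-free type if all predicates (including the
distance) agree on all corresponding subtuples. -/
def SameQFType {M : Type*} [MetricSpace M] {ι : Type*} (k : ι → ℕ)
    (P : ∀ i, (Fin (k i) → M) → ℝ) {n : ℕ} (a b : Fin n → M) : Prop :=
  (∀ s t, dist (a s) (a t) = dist (b s) (b t)) ∧
  ∀ (i : ι) (j : Fin (k i) → Fin n), P i (a ∘ j) = P i (b ∘ j)

/-- A morphism of the relational metric structure: a map preserving all predicates,
in particular (since the distance is among the predicates) distance-preserving. -/
def IsMorphism {M : Type*} [MetricSpace M] {ι : Type*} (k : ι → ℕ)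
    (P : ∀ i, (Fin (k i) → M) → ℝ) (f : M → M) : Prop :=
  Isometry f ∧ ∀ (i : ι) (x : Fin (k i) → M), P i (f ∘ x) = P i x

/-- An automorphism is a surjective morphism. -/
def IsAutomorphism {M : Type*} [MetricSpace M] {ι : Type*} (k : ι → ℕ)
    (P : ∀ i, (Fin (k i) → M) → ℝ) (f : M → M) : Prop :=
  IsMorphism k P f ∧ Function.Surjective f

/-- Approximate ultrahomogeneity: tuples with the same quantifier-free type can be
`ε`-matched by an automorphism. -/
def ApproxUltrahomogeneous {M : Type*} [MetricSpace M] {ι : Type*} (k : ι → ℕ)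
    (P : ∀ i, (Fin (k i) → M) → ℝ) : Prop :=
  ∀ (n : ℕ) (a b : Fin n → M), SameQFType k P a b → ∀ ε : ℝ, 0 < ε →
    ∃ g : M → M, IsAutomorphism k P g ∧ ∀ s, dist (g (a s)) (b s) ≤ ε

/-- Two sets at positive distance are separated by a uniformly continuous function. -/
theorem exists_uniformContinuous_separating {X : Type*} [PseudoMetricSpace X] (A B : Set X)
    {η : ℝ} (hη : 0 < η) (hAB : ∀ a ∈ A, ∀ b ∈ B, η ≤ dist a b) :
    ∃ f : X → ℝ, UniformContinuous f ∧ (∀ p, f p ∈ Set.Icc (0 : ℝ) 1) ∧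
      (∀ b ∈ B, f b = 1) ∧ ∀ a ∈ A, f a = 0 := by
  rcases A.eq_empty_or_nonempty with rfl | hA
  · exact ⟨fun _ => 1, uniformContinuous_const, by simp, by simp, by simp⟩
  refine ⟨fun p => min 1 (infDist p A / η), ?_, fun p => ⟨?_, min_le_left _ _⟩, ?_, ?_⟩
  · have h1 : UniformContinuous fun t : ℝ => t / η := by
      simpa [div_eq_inv_mul] using uniformContinuous_const_smul (X := ℝ) (η⁻¹)
    have h2 : LipschitzWith 1 fun t : ℝ => min 1 t := LipschitzWith.id.const_min 1
    exact h2.uniformContinuous.comp (h1.comp (uniformContinuous_infDist_pt A))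
  · exact le_min zero_le_one (div_nonneg infDist_nonneg hη.le)
  · intro b hb
    apply min_eq_left
    rw [one_le_div hη, le_infDist hA]
    intro a ha
    rw [dist_comm]
    exact hAB a ha b hb
  · intro a ha
    simp [infDist_zero_of_mem ha]

section Controls

variable {M : Type*} [MetricSpace M]

/-- `x` controls `y` if the translates of `y` by elements of `G` which almost fix `x` are almost
covered by finitely many small balls: a metric version of `y` being algebraic over `x`. -/
def Controls (G : Subgroup (M ≃ᵢ M)) (x y : M) : Prop :=
  ∀ ε : ℝ, 0 < ε → ∃ δ : ℝ, 0 < δ ∧ ∃ S : Finset M, ∀ g ∈ G, dist (g x) x < δ →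
    ∃ s ∈ S, dist (g y) s < ε

/-- `ρ` is a pointwise limit of elements of `G`. -/
def IsPointwiseLimit (G : Subgroup (M ≃ᵢ M)) (ρ : M → M) : Prop :=
  ∀ (S : Finset M) (ε : ℝ), 0 < ε → ∃ g ∈ G, ∀ s ∈ S, dist (g s) (ρ s) < ε

variable {G : Subgroup (M ≃ᵢ M)}

theorem Controls.refl (x : M) : Controls G x x :=
  fun ε hε => ⟨ε, hε, {x}, fun g _ h => ⟨x, by simp, h⟩⟩

theorem IsometryEquiv.dist_inv_apply_left (g : M ≃ᵢ M) (x y : M) :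
    dist (g⁻¹ x) y = dist x (g y) := by
  rw [← g.dist_eq, IsometryEquiv.apply_inv_self]

theorem Controls.trans {x y z : M} (hxy : Controls G x y) (hyz : Controls G y z) :
    Controls G x z := by
  classical
  intro ε hε
  obtain ⟨δ, hδ, S, hS⟩ := hyz ε hε
  obtain ⟨δ', hδ', T, hT⟩ := hxy (δ / 2) (half_pos hδ)
  have key : ∀ t : M, ∃ U : Finset M, ∀ g ∈ G, dist (g y) t < δ / 2 →
      ∃ s ∈ U, dist (g z) s < ε := by
    intro t
    by_cases h : ∃ g₀ ∈ G, dist (g₀ y) t < δ / 2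
    · obtain ⟨g₀, hg₀, ht⟩ := h
      refine ⟨S.image g₀, fun g hg hgt => ?_⟩
      obtain ⟨s, hs, hsz⟩ := hS (g₀⁻¹ * g) (G.mul_mem (G.inv_mem hg₀) hg) (by
        rw [IsometryEquiv.mul_apply, IsometryEquiv.dist_inv_apply_left]
        linarith [dist_triangle_right (g y) (g₀ y) t])
      refine ⟨g₀ s, Finset.mem_image_of_mem _ hs, ?_⟩
      rwa [IsometryEquiv.mul_apply, IsometryEquiv.dist_inv_apply_left] at hsz
    · exact ⟨∅, fun g hg hgt => (h ⟨g, hg, hgt⟩).elim⟩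
  choose U hU using key
  refine ⟨δ', hδ', T.biUnion U, fun g hg hgx => ?_⟩
  obtain ⟨t, ht, hty⟩ := hT g hg hgx
  obtain ⟨s, hs, hsz⟩ := hU t g hg hty
  exact ⟨s, Finset.mem_biUnion.2 ⟨t, ht, hs⟩, hsz⟩

theorem Controls.map {x y : M} (h : Controls G x y) {g : M ≃ᵢ M} (hg : g ∈ G) :
    Controls G (g x) (g y) := by
  classical
  intro ε hε
  obtain ⟨δ, hδ, S, hS⟩ := h ε hε
  refine ⟨δ, hδ, S.image g, fun a ha hax => ?_⟩
  obtain ⟨s, hs, hsy⟩ := hS (g⁻¹ * (a * g)) (G.mul_mem (G.inv_mem hg) (G.mul_mem ha hg)) (by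
    rwa [IsometryEquiv.mul_apply, IsometryEquiv.dist_inv_apply_left, IsometryEquiv.mul_apply])
  refine ⟨g s, Finset.mem_image_of_mem _ hs, ?_⟩
  rwa [IsometryEquiv.mul_apply, IsometryEquiv.dist_inv_apply_left, IsometryEquiv.mul_apply] at hsy

/-- The image of a pointwise limit of elements of `G` contains everything controlled by one of
its points. -/
theorem Controls.mem_range [CompleteSpace M] {ρ : M → M} (hρ : Isometry ρ)
    (hlim : IsPointwiseLimit G ρ) {x y : M} (h : Controls G (ρ x) y) : y ∈ Set.range ρ := by
  classical
  have hcl : IsClosed (Set.range ρ) := hρ.isClosedEmbedding.isClosed_range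
  rw [← hcl.closure_eq, Metric.mem_closure_range_iff]
  intro ε hε
  obtain ⟨δ, hδ, S, hS⟩ := h (ε / 2) (half_pos hε)
  obtain ⟨a, ha, hax⟩ := hlim {x} (δ / 2) (half_pos hδ)
  obtain ⟨g, hg, hgS⟩ := hlim (insert x (S.image ⇑a⁻¹)) (min (δ / 2) (ε / 2))
    (lt_min (half_pos hδ) (half_pos hε))
  have hx := (hgS x (Finset.mem_insert_self _ _)).trans_le (min_le_left _ _)
  have hax' := hax x (Finset.mem_singleton_self x)
  obtain ⟨s, hs, hsy⟩ := hS (a * g⁻¹) (G.mul_mem ha (G.inv_mem hg)) (by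
    have h1 : dist ((a * g⁻¹) (ρ x)) (a x) = dist (ρ x) (g x) := by
      rw [IsometryEquiv.mul_apply, a.dist_eq, IsometryEquiv.dist_inv_apply_left]
    have h2 := dist_triangle ((a * g⁻¹) (ρ x)) (a x) (ρ x)
    rw [dist_comm (ρ x)] at h1
    linarith)
  refine ⟨a⁻¹ s, ?_⟩
  have h1 : dist y (g (a⁻¹ s)) < ε / 2 := by
    rw [← IsometryEquiv.dist_inv_apply_left, ← a.dist_eq, IsometryEquiv.apply_inv_self]
    exact hsy
  have h2 := (hgS (a⁻¹ s) (Finset.mem_insert_of_mem (Finset.mem_image_of_mem _ hs))).trans_le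
    (min_le_right _ _)
  linarith [dist_triangle y (g (a⁻¹ s)) (ρ (a⁻¹ s))]

/-- If `x` does not control `y`, then at some scale `ε` the image of any isometry `ρ` contains
translates `(ρ (g x), ρ (g y))` whose first entry is close to `ρ x`, while the second one is
far from any prescribed finite set. -/
theorem exists_far_of_not_controls {x y : M} (h : ¬ Controls G x y) :
    ∃ ε : ℝ, 0 < ε ∧ ∀ ρ : M → M, Isometry ρ → ∀ δ : ℝ, 0 < δ → ∀ S : Finset M, ∃ g ∈ G,
      dist (ρ (g x)) (ρ x) < δ ∧ ∀ s ∈ S, ε ≤ dist (ρ (g y)) s := by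
  classical
  unfold Controls at h
  push Not at h
  obtain ⟨ε, hε, h⟩ := h
  refine ⟨ε / 2, half_pos hε, fun ρ hρ δ hδ S => ?_⟩
  have key : ∀ s : M, ∃ t : M, ∀ z, dist (ρ z) s < ε / 2 → dist z t < ε := by
    intro s
    by_cases hs : ∃ t, dist (ρ t) s < ε / 2
    · obtain ⟨t, ht⟩ := hs
      refine ⟨t, fun z hz => ?_⟩
      rw [← hρ.dist_eq]
      linarith [dist_triangle_right (ρ z) (ρ t) s]
    · exact ⟨s, fun z hz => (hs ⟨z, hz⟩).elim⟩
  choose t ht using key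
  obtain ⟨g, hg, hgx, hgy⟩ := h δ hδ (S.image t)
  refine ⟨g, hg, by rwa [hρ.dist_eq], fun s hs => ?_⟩
  by_contra! hlt
  exact (hgy (t s) (Finset.mem_image_of_mem _ hs)).not_gt (ht s _ hlt)

/-- A Sierpiński-type colouring for a pair of points neither of which controls the other:
compare the times at which the two entries are approached by a dense sequence. -/
theorem exists_separating_of_not_controls [TopologicalSpace.SeparableSpace M] {x y : M}
    (hxy : ¬ Controls G x y) (hyx : ¬ Controls G y x) :
    ∃ (A B : Set (M × M)) (η : ℝ), 0 < η ∧ (∀ a ∈ A, ∀ b ∈ B, η ≤ dist a b) ∧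
      ∀ ρ : M → M, Isometry ρ →
        (∃ g ∈ G, (ρ (g x), ρ (g y)) ∈ A) ∧ ∃ g ∈ G, (ρ (g x), ρ (g y)) ∈ B := by
  classical
  have : Nonempty M := ⟨x⟩
  obtain ⟨ε₁, hε₁, h₁⟩ := exists_far_of_not_controls hxy
  obtain ⟨ε₂, hε₂, h₂⟩ := exists_far_of_not_controls hyx
  obtain ⟨ε, hε, hle₁, hle₂⟩ : ∃ ε : ℝ, 0 < ε ∧ ε ≤ ε₁ ∧ ε ≤ ε₂ :=
    ⟨min ε₁ ε₂, lt_min hε₁ hε₂, min_le_left _ _, min_le_right _ _⟩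
  let c : ℕ → M := TopologicalSpace.denseSeq M
  have hc : DenseRange c := TopologicalSpace.denseRange_denseSeq M
  let E : M → M → Prop := fun u v => ∃ N, dist u (c N) < ε / 2 ∧ ∀ i ≤ N, ε ≤ dist v (c i)
  have hE : ∀ u v u' v' : M, ∀ N N' : ℕ, N ≤ N' → dist u (c N) < ε / 2 →
      (∀ i ≤ N', ε ≤ dist u' (c i)) → ε / 2 ≤ dist (u, v) (u', v') := by
    intro u v u' v' N N' hN hu hu'
    have h1 := hu' N hN
    have h2 : dist u u' ≤ dist (u, v) (u', v') := le_max_left _ _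
    linarith [dist_triangle_left u' (c N) u]
  have hex : ∀ w : M, ∃ N, dist w (c N) < ε / 4 := fun w =>
    Metric.denseRange_iff.1 hc w (ε / 4) (by positivity)
  refine ⟨{p | E p.1 p.2}, {p | E p.2 p.1}, ε / 2, half_pos hε, ?_, fun ρ hρ => ⟨?_, ?_⟩⟩
  · rintro ⟨u, v⟩ ⟨N, hu, hv⟩ ⟨u', v'⟩ ⟨N', hv', hu'⟩
    rcases le_total N N' with h | h
    · exact hE u v u' v' N N' h hu hu'
    · have := hE v' u' v u N' N h hv' hv
      rw [dist_comm, Prod.dist_eq, max_comm] at this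
      rwa [Prod.dist_eq]
  · obtain ⟨N, hN⟩ := hex (ρ x)
    obtain ⟨g, hg, hgx, hgy⟩ := h₁ ρ hρ (ε / 4) (by positivity) ((Finset.range (N + 1)).image c)
    refine ⟨g, hg, N, ?_, fun i hi => ?_⟩
    · change dist (ρ (g x)) (c N) < ε / 2
      linarith [dist_triangle (ρ (g x)) (ρ x) (c N)]
    · exact hle₁.trans (hgy _ (Finset.mem_image_of_mem _ (Finset.mem_range_succ_iff.2 hi)))
  · obtain ⟨N, hN⟩ := hex (ρ y)
    obtain ⟨g, hg, hgx, hgy⟩ := h₂ ρ hρ (ε / 4) (by positivity) ((Finset.range (N + 1)).image c)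
    refine ⟨g, hg, N, ?_, fun i hi => ?_⟩
    · change dist (ρ (g y)) (c N) < ε / 2
      linarith [dist_triangle (ρ (g y)) (ρ y) (c N)]
    · exact hle₂.trans (hgy _ (Finset.mem_image_of_mem _ (Finset.mem_range_succ_iff.2 hi)))

/-- If any two points are comparable for `Controls`, every point of an approximate orbit controls
points of that orbit at a uniform distance. -/
theorem exists_controls_dist_ge (htot : ∀ x y : M, Controls G x y ∨ Controls G y x)
    {O : Set M} {p : M} (hO : ∀ g ∈ G, ∀ z ∈ O, g z ∈ O)
    (hdense : ∀ z ∈ O, ∀ ε : ℝ, 0 < ε → ∃ h ∈ G, dist (h p) z < ε)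
    {g₀ : M ≃ᵢ M} (hg₀ : g₀ ∈ G) (hp : g₀ p ≠ p) {q : M} (hq : q ∈ O) :
    ∃ z ∈ O, Controls G q z ∧ dist (g₀ p) p / 2 ≤ dist z q := by
  have hη : 0 < dist (g₀ p) p := dist_pos.2 hp
  obtain ⟨h, hh, hhq⟩ := hdense q hq (dist (g₀ p) p / 4) (by positivity)
  obtain ⟨g, hg, hgq⟩ : ∃ g ∈ G, dist (g₀ p) p / 2 ≤ dist (g q) q := by
    refine ⟨h * (g₀ * h⁻¹), G.mul_mem hh (G.mul_mem hg₀ (G.inv_mem hh)), ?_⟩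
    have h1 : dist (h (g₀ (h⁻¹ q))) (h (g₀ p)) = dist (h p) q := by
      rw [h.dist_eq, g₀.dist_eq, IsometryEquiv.dist_inv_apply_left, dist_comm]
    have h2 : dist (h (g₀ p)) (h p) = dist (g₀ p) p := h.dist_eq _ _
    simp only [IsometryEquiv.mul_apply]
    linarith [dist_triangle4 (h (g₀ p)) (h (g₀ (h⁻¹ q))) q (h p),
      dist_comm (h (g₀ (h⁻¹ q))) (h (g₀ p)), dist_comm (h p) q]
  rcases htot q (g q) with hc | hc
  · exact ⟨g q, hO g hg q hq, hc, hgq⟩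
  · refine ⟨g⁻¹ q, hO _ (G.inv_mem hg) q hq, ?_, ?_⟩
    · simpa using hc.map (G.inv_mem hg)
    · rwa [IsometryEquiv.dist_inv_apply_left, dist_comm q]

/-- If any two points are comparable for `Controls`, there are two sets at positive distance which
meet every set of points of an approximate orbit controlled by a point of that orbit. -/
theorem exists_separating_of_controls_total [TopologicalSpace.SeparableSpace M]
    (htot : ∀ x y : M, Controls G x y ∨ Controls G y x)
    {O : Set M} {p : M} (hpO : p ∈ O) (hO : ∀ g ∈ G, ∀ z ∈ O, g z ∈ O)
    (hdense : ∀ z ∈ O, ∀ ε : ℝ, 0 < ε → ∃ h ∈ G, dist (h p) z < ε)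
    {g₀ : M ≃ᵢ M} (hg₀ : g₀ ∈ G) (hp : g₀ p ≠ p) :
    ∃ (A B : Set M) (η : ℝ), 0 < η ∧ (∀ a ∈ A, ∀ b ∈ B, η ≤ dist a b) ∧
      ∀ q ∈ O, (∃ z ∈ A, z ∈ O ∧ Controls G q z) ∧ ∃ z ∈ B, z ∈ O ∧ Controls G q z := by
  have : Nonempty M := ⟨p⟩
  obtain ⟨r, hr, hfar⟩ : ∃ r : ℝ, 0 < r ∧ ∀ q ∈ O, ∃ z ∈ O, Controls G q z ∧ 4 * r ≤ dist z q := by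
    refine ⟨dist (g₀ p) p / 8, by have := dist_pos.2 hp; positivity, fun q hq => ?_⟩
    obtain ⟨z, hz, hqz, hd⟩ := exists_controls_dist_ge htot hO hdense hg₀ hp hq
    exact ⟨z, hz, hqz, by linarith⟩
  by_cases hball : ∃ c : M, ∀ q ∈ O, ∃ z ∈ O, Controls G q z ∧ dist z c < r
  · obtain ⟨c, hc⟩ := hball
    refine ⟨{z | dist z c < r}, {z | 2 * r ≤ dist z c}, r, hr, ?_, fun q hq => ⟨?_, ?_⟩⟩
    · intro a (ha : dist a c < r) b (hb : 2 * r ≤ dist b c)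
      linarith [dist_triangle_left b c a]
    · obtain ⟨z, hz, hqz, hd⟩ := hc q hq
      exact ⟨z, hd, hz, hqz⟩
    · obtain ⟨z, hz, hqz, hd⟩ := hfar q hq
      by_cases h : 2 * r ≤ dist q c
      · exact ⟨q, h, hq, Controls.refl q⟩
      · refine ⟨z, ?_, hz, hqz⟩
        change 2 * r ≤ dist z c
        linarith [dist_triangle_right z q c]
  · push Not at hball
    have hmeet : ∀ u v : O, ∃ w : O, Controls G (u : M) w ∧ Controls G (v : M) w := by
      intro u v
      rcases htot (u : M) v with h | h
      · exact ⟨v, h, Controls.refl _⟩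
      · exact ⟨u, Controls.refl _, h⟩
    choose Y hYO hY using hball
    have hstep : ∀ u v : O, ∃ w : O, Controls G (u : M) w ∧ Controls G (v : M) w ∧
        ∀ z ∈ O, Controls G (w : M) z → r ≤ dist z u := by
      intro u v
      obtain ⟨w, hw₁, hw₂⟩ := hmeet u v
      obtain ⟨w', hw'₁, hw'₂⟩ := hmeet w ⟨Y u, hYO u⟩
      exact ⟨w', hw₁.trans hw'₁, hw₂.trans hw'₁, fun z hz hwz => hY u z hz (hw'₂.trans hwz)⟩
    choose m hm₁ hm₂ hm₃ using hstep
    let c : ℕ → M := TopologicalSpace.denseSeq M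
    have hc : DenseRange c := TopologicalSpace.denseRange_denseSeq M
    obtain ⟨w, hw⟩ : ∃ w : ℕ → O, ∀ n, w (n + 1) = m (w n) ⟨Y (c n), hYO (c n)⟩ :=
      ⟨fun n => Nat.rec ⟨p, hpO⟩ (fun n u => m u ⟨Y (c n), hYO (c n)⟩) n, fun _ => rfl⟩
    have hmono : ∀ i j : ℕ, i ≤ j → Controls G (w i : M) (w j) := by
      intro i j hij
      induction hij with
      | refl => exact Controls.refl _
      | step _ ih => exact ih.trans (by rw [hw]; exact hm₁ _ _)
    have hsep : ∀ i j : ℕ, i < j → r ≤ dist (w j : M) (w i) := by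
      intro i j hij
      refine hm₃ (w i) ⟨Y (c i), hYO (c i)⟩ _ (w j).2 ?_
      rw [← hw]
      exact hmono _ _ hij
    have hcoinit : ∀ q ∈ O, ∃ n : ℕ, ∀ j, n ≤ j → Controls G q (w j) := by
      intro q hq
      obtain ⟨n, hn⟩ := Metric.denseRange_iff.1 hc q r hr
      refine ⟨n + 1, fun j hj => Controls.trans (y := (w (n + 1) : M)) ?_ (hmono _ _ hj)⟩
      rcases htot q (w (n + 1)) with h | h
      · exact h
      · refine absurd (hY (c n) q hq (Controls.trans ?_ h)) hn.not_ge
        rw [hw]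
        exact hm₂ (w n) ⟨Y (c n), hYO (c n)⟩
    refine ⟨{z | ∃ n, z = w (2 * n)}, {z | ∃ n, z = w (2 * n + 1)}, r, hr, ?_, fun q hq => ?_⟩
    · rintro _ ⟨i, rfl⟩ _ ⟨j, rfl⟩
      rcases lt_or_gt_of_ne (show 2 * i ≠ 2 * j + 1 by omega) with h | h
      · rw [dist_comm]
        exact hsep _ _ h
      · exact hsep _ _ h
    · obtain ⟨n, hn⟩ := hcoinit q hq
      exact ⟨⟨_, ⟨n, rfl⟩, (w _).2, hn _ (by omega)⟩, ⟨_, ⟨n, rfl⟩, (w _).2, hn _ (by omega)⟩⟩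

end Controls

section Automorphisms

variable {M : Type*} [MetricSpace M] {ι : Type*} (k : ι → ℕ) (P : ∀ i, (Fin (k i) → M) → ℝ)

/-- The automorphisms of a relational metric structure, as a group of isometries. -/
def automorphismSubgroup : Subgroup (M ≃ᵢ M) where
  carrier := {g | ∀ (i : ι) (x : Fin (k i) → M), P i (g ∘ x) = P i x}
  mul_mem' {a b} ha hb i x := (ha i (b ∘ x)).trans (hb i x)
  one_mem' _ _ := rfl
  inv_mem' {a} ha i x := by
    rw [← ha i (⇑a⁻¹ ∘ x)]
    congr 1
    ext j
    simp

variable {k P}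

theorem IsAutomorphism.exists_mem_automorphismSubgroup {g : M → M} (hg : IsAutomorphism k P g) :
    ∃ e ∈ automorphismSubgroup k P, ⇑e = g :=
  ⟨⟨Equiv.ofBijective g ⟨hg.1.1.injective, hg.2⟩, hg.1.1⟩, hg.1.2, rfl⟩

theorem isMorphism_of_mem_automorphismSubgroup {g : M ≃ᵢ M}
    (hg : g ∈ automorphismSubgroup k P) : IsMorphism k P g :=
  ⟨g.isometry, hg⟩

theorem IsMorphism.sameQFType {ρ : M → M} (hρ : IsMorphism k P ρ) {n : ℕ} (a : Fin n → M) :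
    SameQFType k P (ρ ∘ a) a :=
  ⟨fun _ _ => hρ.1.dist_eq _ _, fun i j => hρ.2 i (a ∘ j)⟩

theorem IsMorphism.sameQFType_pair {ρ : M → M} (hρ : IsMorphism k P ρ) (x y : M) :
    SameQFType k P ![ρ x, ρ y] ![x, y] := by
  have h := hρ.sameQFType ![x, y]
  rwa [show ρ ∘ ![x, y] = ![ρ x, ρ y] by ext i; fin_cases i <;> rfl] at h

theorem SameQFType.symm {n : ℕ} {a b : Fin n → M} (h : SameQFType k P a b) :
    SameQFType k P b a :=
  ⟨fun s t => (h.1 s t).symm, fun i j => (h.2 i j).symm⟩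

theorem SameQFType.trans {n : ℕ} {a b c : Fin n → M} (h : SameQFType k P a b)
    (h' : SameQFType k P b c) : SameQFType k P a c :=
  ⟨fun s t => (h.1 s t).trans (h'.1 s t), fun i j => (h.2 i j).trans (h'.2 i j)⟩

theorem ApproxUltrahomogeneous.exists_dist_lt (hhom : ApproxUltrahomogeneous k P) {n : ℕ}
    {a b : Fin n → M} (h : SameQFType k P a b) {ε : ℝ} (hε : 0 < ε) :
    ∃ g ∈ automorphismSubgroup k P, ∀ s, dist (g (a s)) (b s) < ε := by
  obtain ⟨g, hg, hd⟩ := hhom n a b h (ε / 2) (half_pos hε)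
  obtain ⟨e, he, rfl⟩ := hg.exists_mem_automorphismSubgroup
  exact ⟨e, he, fun s => (hd s).trans_lt (half_lt_self hε)⟩

theorem IsMorphism.isPointwiseLimit (hhom : ApproxUltrahomogeneous k P) {ρ : M → M}
    (hρ : IsMorphism k P ρ) : IsPointwiseLimit (automorphismSubgroup k P) ρ := by
  intro S ε hε
  obtain ⟨g, hg, hd⟩ := hhom.exists_dist_lt
    (hρ.sameQFType fun i => (S.equivFin.symm i : M)).symm hε
  refine ⟨g, hg, fun s hs => ?_⟩
  simpa using hd (S.equivFin ⟨s, hs⟩)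

end Automorphisms

/-- Oscillation theorem for metric structures: if `M` is an approximately
ultrahomogeneous Polish relational metric structure with more than one automorphism,
there exist a uniformly continuous `f : M² → [0,1]` and a pair `(a₀,a₁)` such that every
morphism's image contains pairs of the same quantifier-free type as `(a₀,a₁)` on which
`f` takes both values `1` and `0`. -/
theorem oscillation_metric_structures {M : Type*} [MetricSpace M]
    [CompleteSpace M] [TopologicalSpace.SeparableSpace M]
    (hd : ∀ x y : M, dist x y ≤ 1)
    {ι : Type*} (k : ι → ℕ) (P : ∀ i, (Fin (k i) → M) → ℝ)
    (hUC : ∀ i, UniformContinuous (P i))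
    (hrange : ∀ i x, P i x ∈ Set.Icc (0:ℝ) 1)
    (hhom : ApproxUltrahomogeneous k P)
    (hnontriv : ∃ g : M → M, IsAutomorphism k P g ∧ g ≠ id) :
    ∃ f : M × M → ℝ, UniformContinuous f ∧ (∀ p, f p ∈ Set.Icc (0:ℝ) 1) ∧
      ∃ a₀ a₁ : M, ∀ ρ : M → M, IsMorphism k P ρ →
        ∃ b₀ ∈ Set.range ρ, ∃ b₁ ∈ Set.range ρ, ∃ c₀ ∈ Set.range ρ, ∃ c₁ ∈ Set.range ρ,
          SameQFType k P ![b₀, b₁] ![a₀, a₁] ∧ SameQFType k P ![c₀, c₁] ![a₀, a₁] ∧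
          f (b₀, b₁) = 1 ∧ f (c₀, c₁) = 0 := by
  by_cases hcase : ∃ x y : M, ¬ Controls (automorphismSubgroup k P) x y ∧
      ¬ Controls (automorphismSubgroup k P) y x
  · obtain ⟨x, y, hxy, hyx⟩ := hcase
    obtain ⟨A, B, η, hη, hAB, h⟩ := exists_separating_of_not_controls hxy hyx
    obtain ⟨f, hf, hf01, hfB, hfA⟩ := exists_uniformContinuous_separating A B hη hAB
    refine ⟨f, hf, hf01, x, y, fun ρ hρ => ?_⟩
    obtain ⟨⟨g, hg, hgA⟩, g', hg', hgB⟩ := h ρ hρ.1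
    have htype : ∀ a ∈ automorphismSubgroup k P,
        SameQFType k P ![ρ (a x), ρ (a y)] ![x, y] := fun a ha =>
      (hρ.sameQFType_pair _ _).trans
        ((isMorphism_of_mem_automorphismSubgroup ha).sameQFType_pair x y)
    exact ⟨_, mem_range_self _, _, mem_range_self _, _, mem_range_self _, _, mem_range_self _,
      htype g' hg', htype g hg, hfB _ hgB, hfA _ hgA⟩
  · have htot : ∀ x y : M, Controls (automorphismSubgroup k P) x y ∨
        Controls (automorphismSubgroup k P) y x := by
      intro x y
      by_contra! hc
      exact hcase ⟨x, y, hc⟩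
    obtain ⟨g, hg, hgid⟩ := hnontriv
    obtain ⟨g₀, hg₀, rfl⟩ := hg.exists_mem_automorphismSubgroup
    obtain ⟨p, hp⟩ := Function.ne_iff.1 hgid
    let O : Set M := {z | SameQFType k P ![z, z] ![p, p]}
    have hmap : ∀ ρ : M → M, IsMorphism k P ρ → ∀ z ∈ O, ρ z ∈ O := fun ρ hρ z hz =>
      (hρ.sameQFType_pair z z).trans hz
    have hpO : p ∈ O := ⟨fun _ _ => rfl, fun _ _ => rfl⟩
    obtain ⟨A, B, η, hη, hAB, h⟩ := exists_separating_of_controls_total htot hpO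
      (fun a ha => hmap a (isMorphism_of_mem_automorphismSubgroup ha))
      (fun z hz ε hε => by
        obtain ⟨a, ha, hd⟩ := hhom.exists_dist_lt (SameQFType.symm hz) hε
        exact ⟨a, ha, hd 0⟩) hg₀ hp
    obtain ⟨f, hf, hf01, hfB, hfA⟩ := exists_uniformContinuous_separating A B hη hAB
    refine ⟨fun q => f q.1, hf.comp uniformContinuous_fst, fun q => hf01 q.1, p, p,
      fun ρ hρ => ?_⟩
    obtain ⟨⟨c, hcA, hcO, hc⟩, b, hbB, hbO, hb⟩ := h (ρ p) (hmap ρ hρ p hpO)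
    have hlim := hρ.isPointwiseLimit hhom
    have hcρ := hc.mem_range hρ.1 hlim
    have hbρ := hb.mem_range hρ.1 hlim
    exact ⟨b, hbρ, b, hbρ, c, hcρ, c, hcρ, hbO, hcO, hfB b hbB, hfA c hcA⟩
end
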